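/- Let f, r : ℝ → ℝ be of class C² with r uniformly Lipschitz. Then there exist positive constants a and b, depending only on r, such that every classical solution y of y_t + (f(y))_x = y_xx + r(y) on [0,1] × (0,T) with homogeneous Dirichlet boundary conditions satisfies ‖y(·,t)‖² ≤ e^{at} ( ‖y(·,0)‖² + bt ) for all 0 ≤ t < T, where ‖·‖ denotes the L²(0,1) norm. -/

import Mathlib

open Set MeasureTheory intervalIntegral

/-- `y` is a classical solution of `y_t + (f(y))_x = y_xx + r(y)` on `[0,1] × (0,T)`
with homogeneous Dirichlet boundary conditions. -/
def IsClassicalSolutionOn (f r : ℝ → ℝ) (T : ℝ) (y : ℝ → ℝ → ℝ) : Prop :=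
  ContinuousOn (fun pt : ℝ × ℝ => y pt.1 pt.2) (Icc 0 1 ×ˢ Ico 0 T) ∧
  (∀ t ∈ Ioo (0:ℝ) T, ContDiffOn ℝ 2 (fun x => y x t) (Icc 0 1)) ∧
  (∀ t ∈ Ico (0:ℝ) T, y 0 t = 0 ∧ y 1 t = 0) ∧
  (∀ x ∈ Ioo (0:ℝ) 1, ∀ t ∈ Ioo (0:ℝ) T,
    HasDerivAt (fun s => y x s)
      (deriv (deriv (fun x' => y x' t)) x - deriv (fun x' => f (y x' t)) x + r (y x t)) t)

section

open Filter Topology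

/-- The first two derivatives of a `C²` function on `[0,1]`, up to the boundary. -/
theorem exists_hasDerivAt_of_contDiffOn_two {u : ℝ → ℝ} (hu : ContDiffOn ℝ 2 u (Icc 0 1)) :
    ∃ p q : ℝ → ℝ, ContinuousOn p (Icc 0 1) ∧ ContinuousOn q (Icc 0 1) ∧
      ∀ x ∈ Ioo (0:ℝ) 1, HasDerivAt u (p x) x ∧ HasDerivAt p (q x) x ∧
        deriv u x = p x ∧ deriv (deriv u) x = q x := by
  have hU : UniqueDiffOn ℝ (Icc (0:ℝ) 1) := uniqueDiffOn_Icc zero_lt_one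
  have h1 : ContDiffOn ℝ 1 (derivWithin u (Icc 0 1)) (Icc 0 1) :=
    hu.derivWithin hU (by norm_num)
  have hp : ∀ x ∈ Ioo (0:ℝ) 1, HasDerivAt u (derivWithin u (Icc 0 1) x) x := fun x hx =>
    ((hu.differentiableOn (by norm_num)) x (Ioo_subset_Icc_self hx)).hasDerivWithinAt.hasDerivAt
      (Icc_mem_nhds hx.1 hx.2)
  have hq : ∀ x ∈ Ioo (0:ℝ) 1, HasDerivAt (derivWithin u (Icc 0 1))
      (derivWithin (derivWithin u (Icc 0 1)) (Icc 0 1) x) x := fun x hx =>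
    ((h1.differentiableOn (by norm_num)) x (Ioo_subset_Icc_self hx)).hasDerivWithinAt.hasDerivAt
      (Icc_mem_nhds hx.1 hx.2)
  refine ⟨_, _, h1.continuousOn, h1.continuousOn_derivWithin hU le_rfl, fun x hx =>
    ⟨hp x hx, hq x hx, (hp x hx).deriv, ?_⟩⟩
  have : deriv u =ᶠ[𝓝 x] derivWithin u (Icc 0 1) := by
    filter_upwards [Ioo_mem_nhds hx.1 hx.2] with z hz using (hp z hz).deriv
  rw [this.deriv_eq, (hq x hx).deriv]

/-- Necessary second-order condition at a local maximum. -/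
theorem IsLocalMax.deriv_deriv_nonpos {w : ℝ → ℝ} {x : ℝ} (h : IsLocalMax w x)
    (hc : ContinuousAt w x) : deriv (deriv w) x ≤ 0 := by
  by_contra! hpos
  have hmin := isLocalMin_of_deriv_deriv_pos hpos h.deriv_eq_zero hc
  have hconst : w =ᶠ[𝓝 x] fun _ => w x := by
    filter_upwards [h, hmin] with z h1 h2 using le_antisymm h1 h2
  have := hconst.deriv.deriv_eq
  simp at this
  linarith

/-- A function bounded on the left by its value at `t` has nonnegative derivative at `t`. -/
theorem HasDerivAt.nonneg_of_eventually_le_left {w : ℝ → ℝ} {w' t : ℝ} (h : HasDerivAt w w' t)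
    (hle : ∀ᶠ s in 𝓝[<] t, w s ≤ w t) : 0 ≤ w' := by
  refine ge_of_tendsto (hasDerivAt_iff_tendsto_slope_left_right.1 h).1 ?_
  filter_upwards [hle, self_mem_nhdsWithin] with s h1 h2
  rw [slope_def_field]
  exact div_nonneg_of_nonpos (by linarith) (by linarith [mem_Iio.1 h2])

namespace IsClassicalSolutionOn

variable {f r : ℝ → ℝ} {T : ℝ} {y : ℝ → ℝ → ℝ}

theorem continuousOn_slice (h : IsClassicalSolutionOn f r T y) {t : ℝ} (ht : t ∈ Ico 0 T) :
    ContinuousOn (fun x => y x t) (Icc 0 1) :=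
  h.1.comp (f := fun x : ℝ => (x, t)) (by fun_prop) fun _ hx => ⟨hx, ht⟩

/-- The reflection `-y` of a classical solution is again a classical solution, for the reflected
nonlinearities. -/
theorem neg (h : IsClassicalSolutionOn f r T y) :
    IsClassicalSolutionOn (fun z => -f (-z)) (fun z => -r (-z)) T (fun x t => -y x t) := by
  obtain ⟨h1, h2, h3, h4⟩ := h
  refine ⟨h1.neg, fun t ht => (h2 t ht).neg, fun t ht => by simp [h3 t ht], fun x hx t ht => ?_⟩
  have h5 := (h4 x hx t ht).neg
  have e : deriv (fun x' => -y x' t) = fun x => -deriv (fun x' => y x' t) x := by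
    ext z; exact deriv.fun_neg
  refine h5.congr_deriv ?_
  simp only [e, neg_neg, deriv.fun_neg]
  ring

/-- A bound for `|y|` on a compact time interval. -/
theorem exists_bound (h : IsClassicalSolutionOn f r T y) {s τ : ℝ} (hs : 0 ≤ s) (hτ : τ < T) :
    ∃ M, ∀ x ∈ Icc (0:ℝ) 1, ∀ t ∈ Icc s τ, |y x t| ≤ M := by
  obtain ⟨M, hM⟩ :=
    (isCompact_Icc.prod (isCompact_Icc (a := s) (b := τ))).exists_bound_of_continuousOn
    (h.1.mono (prod_mono_right fun t ht => ⟨hs.trans ht.1, ht.2.trans_lt hτ⟩))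
  exact ⟨M, fun x hx t ht => hM (x, t) ⟨hx, ht⟩⟩

/-- Comparison with the barrier `y(x,s) + C (t - s)`. -/
theorem exists_sub_le (h : IsClassicalSolutionOn f r T y) (hf : ContDiff ℝ 1 f)
    (hr : Continuous r) {s τ : ℝ} (hs : s ∈ Ioo 0 T) (hτ : τ < T) :
    ∃ C, ∀ x ∈ Icc (0:ℝ) 1, ∀ t ∈ Icc s τ, y x t - y x s ≤ C * (t - s) := by
  obtain ⟨M, hM⟩ := h.exists_bound hs.1.le hτ
  obtain ⟨p, q, hp, hq, hpq⟩ := exists_hasDerivAt_of_contDiffOn_two (h.2.1 s hs)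
  have hf' : Continuous (deriv f) := hf.continuous_deriv le_rfl
  obtain ⟨B, hB⟩ :=
    (isCompact_Icc.prod (isCompact_Icc (a := -M) (b := M))).exists_bound_of_continuousOn
    (f := fun w : ℝ × ℝ => q w.1 - deriv f w.2 * p w.1 + r w.2) (s := Icc (0:ℝ) 1 ×ˢ Icc (-M) M)
    (((hq.comp continuousOn_fst fun w hw => hw.1).sub
      ((hf'.comp continuous_snd).continuousOn.mul
        (hp.comp continuousOn_fst fun w hw => hw.1))).add (hr.comp continuous_snd).continuousOn)
  refine ⟨|B| + 1, ?_⟩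
  by_contra! hcon
  obtain ⟨x₁, hx₁, t₁, ht₁, hlt⟩ := hcon
  set C := |B| + 1 with hC
  have hsub : Icc s τ ⊆ Ico 0 T := fun t ht => ⟨hs.1.le.trans ht.1, ht.2.trans_lt hτ⟩
  have hsτ : s ≤ τ := ht₁.1.trans ht₁.2
  have hcont : ContinuousOn (fun w : ℝ × ℝ => y w.1 w.2 - y w.1 s - C * (w.2 - s))
      (Icc 0 1 ×ˢ Icc s τ) :=
    ((h.1.mono (prod_mono_right hsub)).sub
      ((h.continuousOn_slice (hsub ⟨le_rfl, hsτ⟩)).comp continuousOn_fst fun w hw => hw.1)).sub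
      (by fun_prop)
  obtain ⟨⟨x, t⟩, ⟨hx, ht⟩, hmax⟩ :=
    (isCompact_Icc.prod isCompact_Icc).exists_isMaxOn ⟨(x₁, t₁), hx₁, ht₁⟩ hcont
  simp only at hx ht
  have hmax' : ∀ x' ∈ Icc (0:ℝ) 1, ∀ t' ∈ Icc s τ,
      y x' t' - y x' s - C * (t' - s) ≤ y x t - y x s - C * (t - s) :=
    fun x' hx' t' ht' => hmax (show (x', t') ∈ _ from ⟨hx', ht'⟩)
  have hpos : 0 < y x t - y x s - C * (t - s) := by
    linarith [hmax' x₁ hx₁ t₁ ht₁]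
  have hCpos : 0 < C := by positivity
  have hts : s < t := by
    refine lt_of_le_of_ne ht.1 fun e => ?_
    subst e
    simp at hpos
  have hbd := h.2.2.1 t (hsub ht)
  have hbs := h.2.2.1 s (hsub ⟨le_rfl, hsτ⟩)
  have hCt : 0 ≤ C * (t - s) := mul_nonneg hCpos.le (by linarith)
  have hx0 : 0 < x := by
    refine lt_of_le_of_ne hx.1 fun e => ?_
    rw [← e] at hpos
    linarith [hbd.1, hbs.1]
  have hx1 : x < 1 := by
    refine lt_of_le_of_ne hx.2 fun e => ?_
    rw [e] at hpos
    linarith [hbd.2, hbs.2]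
  have htT : t ∈ Ioo 0 T := ⟨hs.1.trans hts, (hsub ht).2⟩
  have hxI : x ∈ Ioo (0:ℝ) 1 := ⟨hx0, hx1⟩
  obtain ⟨p', q', -, -, hpq'⟩ := exists_hasDerivAt_of_contDiffOn_two (h.2.1 t htT)
  have hloc : IsLocalMax (fun z => y z t - y z s) x := by
    filter_upwards [Ioo_mem_nhds hx0 hx1] with z hz
    linarith [hmax' z (Ioo_subset_Icc_self hz) t ht]
  have hder : ∀ z ∈ Ioo (0:ℝ) 1, HasDerivAt (fun z => y z t - y z s) (p' z - p z) z :=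
    fun z hz => (hpq' z hz).1.sub (hpq z hz).1
  have hpp : p' x = p x := by
    have := hloc.hasDerivAt_eq_zero (hder x hxI)
    linarith
  have hqq : q' x ≤ q x := by
    have h1 := hloc.deriv_deriv_nonpos (hder x hxI).continuousAt
    have h2 : deriv (fun z => y z t - y z s) =ᶠ[𝓝 x] fun z => p' z - p z := by
      filter_upwards [Ioo_mem_nhds hx0 hx1] with z hz using (hder z hz).deriv
    rw [h2.deriv_eq, ((hpq' x hxI).2.1.fun_sub (hpq x hxI).2.1).deriv] at h1
    linarith
  have hfd : deriv (fun x' => f (y x' t)) x = deriv f (y x t) * p' x :=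
    ((hf.differentiable one_ne_zero (y x t)).hasDerivAt.comp x (hpq' x hxI).1).deriv
  have htime := h.2.2.2 x hxI t htT
  rw [hfd, (hpq' x hxI).2.2.2, hpp] at htime
  have hnn := (htime.sub (((hasDerivAt_id t).sub_const s).const_mul C)).nonneg_of_eventually_le_left
    (by
      filter_upwards [Ioo_mem_nhdsLT hts] with t' ht'
      have := hmax' x hx t' ⟨ht'.1.le, ht'.2.le.trans ht.2⟩
      simp only [Pi.sub_apply, id]
      linarith)
  have hb := hB (x, y x t) ⟨hx, abs_le.1 (hM x hx t ht)⟩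
  have := (le_abs_self _).trans hb
  simp only at this
  linarith [le_abs_self B]

/-- One-sided Lipschitz estimate in time, uniform in space, starting at a positive time. -/
theorem exists_abs_sub_le (h : IsClassicalSolutionOn f r T y) (hf : ContDiff ℝ 1 f)
    (hr : Continuous r) {s τ : ℝ} (hs : s ∈ Ioo 0 T) (hτ : τ < T) :
    ∃ C, ∀ x ∈ Icc (0:ℝ) 1, ∀ t ∈ Icc s τ, |y x t - y x s| ≤ C * (t - s) := by
  obtain ⟨C₁, hC₁⟩ := h.exists_sub_le hf hr hs hτ
  obtain ⟨C₂, hC₂⟩ := h.neg.exists_sub_le (hf.comp contDiff_neg).neg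
    (hr.comp continuous_neg).neg hs hτ
  refine ⟨max C₁ C₂, fun x hx t ht => abs_le.2 ⟨?_, ?_⟩⟩
  · have := mul_le_mul_of_nonneg_right (le_max_right C₁ C₂) (sub_nonneg.2 ht.1)
    linarith [hC₂ x hx t ht]
  · have := mul_le_mul_of_nonneg_right (le_max_left C₁ C₂) (sub_nonneg.2 ht.1)
    linarith [hC₁ x hx t ht]

theorem continuousOn_integral_sq (h : IsClassicalSolutionOn f r T y) {τ : ℝ} (hτ : τ < T) :
    ContinuousOn (fun t => ∫ x in (0:ℝ)..1, y x t ^ 2) (Icc 0 τ) := by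
  obtain ⟨M, hM⟩ := h.exists_bound le_rfl hτ
  have hsub : Icc 0 τ ⊆ Ico 0 T := fun t ht => ⟨ht.1, ht.2.trans_lt hτ⟩
  intro t ht
  refine intervalIntegral.continuousWithinAt_of_dominated_interval (bound := fun _ => M ^ 2)
    ?_ ?_ intervalIntegrable_const ?_
  · filter_upwards [self_mem_nhdsWithin] with t' ht'
    rw [uIoc_of_le zero_le_one]
    exact (((h.continuousOn_slice (hsub ht')).pow 2).mono
      Ioc_subset_Icc_self).aestronglyMeasurable measurableSet_Ioc
  · filter_upwards [self_mem_nhdsWithin] with t' ht'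
    refine Eventually.of_forall fun x hx => ?_
    rw [uIoc_of_le zero_le_one] at hx
    rw [norm_pow, Real.norm_eq_abs]
    exact pow_le_pow_left₀ (abs_nonneg _) (hM x (Ioc_subset_Icc_self hx) t' ht') 2
  · refine Eventually.of_forall fun x hx => ?_
    rw [uIoc_of_le zero_le_one] at hx
    exact ((h.1.comp (f := fun t : ℝ => (x, t)) (s := Icc 0 τ) (by fun_prop)
      fun t ht => ⟨Ioc_subset_Icc_self hx, hsub ht⟩).pow 2) t ht

/-- The energy `‖y(·,t)‖²` has a right derivative at every positive time, given by
differentiation under the integral sign. -/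
theorem hasDerivWithinAt_integral_sq (h : IsClassicalSolutionOn f r T y) (hf : ContDiff ℝ 1 f)
    (hr : Continuous r) {s : ℝ} (hs : s ∈ Ioo 0 T) {g : ℝ → ℝ}
    (hg : ∀ x ∈ Ioo (0:ℝ) 1, HasDerivAt (fun t => y x t) (g x) s) :
    HasDerivWithinAt (fun t => ∫ x in (0:ℝ)..1, y x t ^ 2)
      (∫ x in (0:ℝ)..1, 2 * y x s * g x) (Ici s) s := by
  obtain ⟨τ, hsτ, hτ⟩ := exists_between hs.2
  obtain ⟨M, hM⟩ := h.exists_bound hs.1.le hτ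
  obtain ⟨C, hC⟩ := h.exists_abs_sub_le hf hr hs hτ
  have hsub : Icc s τ ⊆ Ico 0 T := fun t ht => ⟨hs.1.le.trans ht.1, ht.2.trans_lt hτ⟩
  have hss : s ∈ Icc s τ := ⟨le_rfl, hsτ.le⟩
  have hint : ∀ t ∈ Icc s τ, IntervalIntegrable (fun x => y x t ^ 2) volume 0 1 := fun t ht =>
    ((h.continuousOn_slice (hsub ht)).pow 2).intervalIntegrable_of_Icc zero_le_one
  rw [← hasDerivWithinAt_Ioi_iff_Ici, hasDerivWithinAt_iff_tendsto_slope' self_notMem_Ioi]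
  have hslope : (fun t => ∫ x in (0:ℝ)..1, slope (fun t => y x t ^ 2) s t) =ᶠ[𝓝[>] s]
      slope (fun t => ∫ x in (0:ℝ)..1, y x t ^ 2) s := by
    filter_upwards [Ioo_mem_nhdsGT hsτ] with t ht
    simp only [slope_def_field]
    rw [intervalIntegral.integral_div,
      intervalIntegral.integral_sub (hint t (Ioo_subset_Icc_self ht)) (hint s hss)]
  refine Tendsto.congr' hslope ?_
  refine intervalIntegral.tendsto_integral_filter_of_dominated_convergence
    (fun _ => C * (2 * M)) ?_ ?_ intervalIntegrable_const ?_
  · filter_upwards [Ioo_mem_nhdsGT hsτ] with t ht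
    simp only [slope_def_field]
    rw [uIoc_of_le zero_le_one]
    exact (((((h.continuousOn_slice (hsub (Ioo_subset_Icc_self ht))).pow 2).sub
      ((h.continuousOn_slice (hsub hss)).pow 2)).div_const (t - s)).mono
      Ioc_subset_Icc_self).aestronglyMeasurable measurableSet_Ioc
  · filter_upwards [Ioo_mem_nhdsGT hsτ] with t ht
    refine Eventually.of_forall fun x hx => ?_
    rw [uIoc_of_le zero_le_one] at hx
    have hx' := Ioc_subset_Icc_self hx
    have ht' := Ioo_subset_Icc_self ht
    have hpos : 0 < t - s := sub_pos.2 ht.1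
    rw [slope_def_field, Real.norm_eq_abs, abs_div, abs_of_pos hpos, div_le_iff₀ hpos,
      sq_sub_sq, abs_mul]
    have h1 : |y x t + y x s| ≤ 2 * M := by
      linarith [abs_add_le (y x t) (y x s), hM x hx' t ht', hM x hx' s hss]
    calc |y x t + y x s| * |y x t - y x s| ≤ 2 * M * (C * (t - s)) :=
          mul_le_mul h1 (hC x hx' t ht') (abs_nonneg _) ((abs_nonneg _).trans h1)
      _ = C * (2 * M) * (t - s) := by ring
  · have hne : ∀ᵐ x : ℝ, x ≠ 1 := by simp [ae_iff]
    filter_upwards [hne] with x hx1 hx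
    rw [uIoc_of_le zero_le_one] at hx
    have h2 := (hg x ⟨hx.1, lt_of_le_of_ne hx.2 hx1⟩).fun_pow 2
    simpa using (hasDerivAt_iff_tendsto_slope_left_right.1 h2).2

end IsClassicalSolutionOn

/-- A flux term `u (f(u))_x` integrates to zero for `u` vanishing at both ends. -/
theorem integral_mul_deriv_flux_eq_zero {f u p : ℝ → ℝ} (hf : Continuous (deriv f))
    (hu : ContinuousOn u (Icc 0 1)) (hp : ContinuousOn p (Icc 0 1))
    (hup : ∀ x ∈ Ioo (0:ℝ) 1, HasDerivAt u (p x) x) (h0 : u 0 = 0) (h1 : u 1 = 0) :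
    ∫ x in (0:ℝ)..1, u x * (deriv f (u x) * p x) = 0 := by
  have hk : Continuous fun w => w * deriv f w := continuous_id.mul hf
  set G : ℝ → ℝ := fun z => ∫ w in (0:ℝ)..z, w * deriv f w
  have hGd : ∀ z, HasDerivAt G (z * deriv f z) z := fun z =>
    (hk.integral_hasStrictDerivAt 0 z).hasDerivAt
  have hGc : Continuous G := continuous_iff_continuousAt.2 fun z => (hGd z).continuousAt
  have hFTC := intervalIntegral.integral_eq_sub_of_hasDerivAt_of_le
    (f' := fun x => u x * (deriv f (u x) * p x)) zero_le_one (hGc.comp_continuousOn hu)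
    (fun x hx => by
      have := (hGd (u x)).comp x (hup x hx)
      rwa [mul_assoc] at this)
    ((hu.mul ((hf.comp_continuousOn hu).mul hp)).intervalIntegrable_of_Icc zero_le_one)
  rw [hFTC]
  simp [h0, h1]

/-- The energy inequality for a slice vanishing at both ends. -/
theorem integral_energy_le {f r u p q : ℝ → ℝ} {K : NNReal} (hf : Continuous (deriv f))
    (hr : LipschitzWith K r) (hu : ContinuousOn u (Icc 0 1)) (hp : ContinuousOn p (Icc 0 1))
    (hq : ContinuousOn q (Icc 0 1)) (hup : ∀ x ∈ Ioo (0:ℝ) 1, HasDerivAt u (p x) x)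
    (hpq : ∀ x ∈ Ioo (0:ℝ) 1, HasDerivAt p (q x) x) (h0 : u 0 = 0) (h1 : u 1 = 0) :
    ∫ x in (0:ℝ)..1, 2 * u x * (q x - deriv f (u x) * p x + r (u x)) ≤
      (2 * K + 1) * (∫ x in (0:ℝ)..1, u x ^ 2) + r 0 ^ 2 := by
  have hparts := intervalIntegral.integral_mul_deriv_eq_deriv_mul_of_hasDerivAt
    (a := 0) (b := 1) (u := u) (v := p) (u' := p) (v' := q)
    (by rwa [uIcc_of_le zero_le_one]) (by rwa [uIcc_of_le zero_le_one])
    (by simpa using fun x h0 h1 => hup x ⟨h0, h1⟩)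
    (by simpa using fun x h0 h1 => hpq x ⟨h0, h1⟩)
    (hp.intervalIntegrable_of_Icc zero_le_one) (hq.intervalIntegrable_of_Icc zero_le_one)
  have hpp : 0 ≤ ∫ x in (0:ℝ)..1, p x * p x :=
    intervalIntegral.integral_nonneg zero_le_one fun x _ => mul_self_nonneg _
  have hflux := integral_mul_deriv_flux_eq_zero hf hu hp hup h0 h1
  have I1 : IntervalIntegrable (fun x => u x * q x) volume 0 1 :=
    (hu.mul hq).intervalIntegrable_of_Icc zero_le_one
  have I2 : IntervalIntegrable (fun x => u x * (deriv f (u x) * p x)) volume 0 1 :=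
    (hu.mul ((hf.comp_continuousOn hu).mul hp)).intervalIntegrable_of_Icc zero_le_one
  have I3 : IntervalIntegrable (fun x => 2 * u x * r (u x)) volume 0 1 :=
    ((continuousOn_const.mul hu).mul
      (hr.continuous.comp_continuousOn hu)).intervalIntegrable_of_Icc zero_le_one
  have I4 : IntervalIntegrable (fun x => u x ^ 2) volume 0 1 :=
    (hu.pow 2).intervalIntegrable_of_Icc zero_le_one
  have hreact : ∫ x in (0:ℝ)..1, 2 * u x * r (u x) ≤
      ∫ x in (0:ℝ)..1, ((2 * K + 1) * u x ^ 2 + r 0 ^ 2) := by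
    refine intervalIntegral.integral_mono_on zero_le_one I3
      ((I4.const_mul _).add intervalIntegrable_const) fun x _ => ?_
    have hL := hr.dist_le_mul (u x) 0
    rw [Real.dist_eq, Real.dist_eq, sub_zero] at hL
    have h2 : u x * (r (u x) - r 0) ≤ K * u x ^ 2 := by
      calc u x * (r (u x) - r 0) ≤ |u x| * |r (u x) - r 0| := by
            rw [← abs_mul]; exact le_abs_self _
        _ ≤ |u x| * (K * |u x|) := mul_le_mul_of_nonneg_left hL (abs_nonneg _)
        _ = K * u x ^ 2 := by rw [← sq_abs (u x)]; ring
    nlinarith [sq_nonneg (u x - r 0)]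
  rw [intervalIntegral.integral_add (I4.const_mul _) intervalIntegrable_const,
    intervalIntegral.integral_const_mul, intervalIntegral.integral_const] at hreact
  have hsplit : ∫ x in (0:ℝ)..1, 2 * u x * (q x - deriv f (u x) * p x + r (u x)) =
      2 * (∫ x in (0:ℝ)..1, u x * q x) - 2 * (∫ x in (0:ℝ)..1, u x * (deriv f (u x) * p x)) +
        ∫ x in (0:ℝ)..1, 2 * u x * r (u x) := by
    rw [← intervalIntegral.integral_const_mul, ← intervalIntegral.integral_const_mul,
      ← intervalIntegral.integral_sub (I1.const_mul 2) (I2.const_mul 2),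
      ← intervalIntegral.integral_add ((I1.const_mul 2).sub (I2.const_mul 2)) I3]
    congr 1
    ext x
    ring
  rw [hsplit, hflux, hparts, h0, h1]
  simp only [sub_zero, one_smul] at hreact
  linarith

end

/-- `L²` growth estimate `‖y(·,t)‖² ≤ e^{at} (‖y(·,0)‖² + bt)`, with
positive constants `a`, `b` depending only on `r`. -/
theorem L2_growth_estimate
    (r : ℝ → ℝ) (hr : ContDiff ℝ 2 r) (hrLip : ∃ K : NNReal, LipschitzWith K r) :
    ∃ a > (0:ℝ), ∃ b > (0:ℝ), ∀ f : ℝ → ℝ, ContDiff ℝ 2 f →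
      ∀ (T : ℝ) (y : ℝ → ℝ → ℝ), IsClassicalSolutionOn f r T y →
        ∀ t ∈ Ico (0:ℝ) T,
          (∫ x in (0:ℝ)..1, (y x t) ^ 2) ≤
            Real.exp (a * t) * ((∫ x in (0:ℝ)..1, (y x 0) ^ 2) + b * t) := by
  obtain ⟨K, hK⟩ := hrLip
  refine ⟨2 * K + 1, by positivity, r 0 ^ 2 + 1, by positivity, fun f hf T y h t ht => ?_⟩
  set a : ℝ := 2 * K + 1
  set b : ℝ := r 0 ^ 2 + 1 with hb
  have ha0 : 0 < a := by positivity
  have hb0 : 0 < b := by positivity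
  set E : ℝ → ℝ := fun t => ∫ x in (0:ℝ)..1, y x t ^ 2
  change E t ≤ Real.exp (a * t) * (E 0 + b * t)
  rcases ht.1.eq_or_lt with rfl | ht0
  · simp
  have hEc : ContinuousOn E (Icc 0 t) := h.continuousOn_integral_sq ht.2
  have hf1 : ContDiff ℝ 1 f := hf.of_le (by norm_num)
  have hf' : Continuous (deriv f) := hf1.continuous_deriv le_rfl
  have hderiv : ∀ s ∈ Ioo 0 T, ∃ E' ≤ a * E s + b, HasDerivWithinAt E E' (Ici s) s := by
    intro s hs
    obtain ⟨p, q, hp, hq, hpq⟩ := exists_hasDerivAt_of_contDiffOn_two (h.2.1 s hs)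
    have hs' : s ∈ Ico 0 T := ⟨hs.1.le, hs.2⟩
    refine ⟨_, ?_, h.hasDerivWithinAt_integral_sq hf1 hr.continuous hs
      (g := fun x => q x - deriv f (y x s) * p x + r (y x s)) fun x hx => ?_⟩
    · have := integral_energy_le hf' hK (h.continuousOn_slice hs') hp hq
        (fun x hx => (hpq x hx).1) (fun x hx => (hpq x hx).2.1) (h.2.2.1 s hs').1 (h.2.2.1 s hs').2
      exact this.trans (by rw [hb]; linarith)
    · have hfd : deriv (fun x' => f (y x' s)) x = deriv f (y x s) * p x :=
        ((hf1.differentiable one_ne_zero (y x s)).hasDerivAt.comp x (hpq x hx).1).deriv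
      have := h.2.2.2 x hx s hs
      rwa [hfd, (hpq x hx).2.2.2] at this
  choose! E' hE'le hE' using hderiv
  have hexp : ∀ s, HasDerivAt (fun s => Real.exp (-(a * s))) (Real.exp (-(a * s)) * -a) s :=
    fun s => by simpa using ((hasDerivAt_id s).const_mul a).neg.exp
  have hexpc : Continuous fun s => Real.exp (-(a * s)) := by fun_prop
  have key : ∀ s ∈ Ioc 0 t,
      Real.exp (-(a * t)) * E t ≤ Real.exp (-(a * s)) * E s + b * (t - s) := by
    intro s hs
    have hI : ∀ x ∈ Ico s t, x ∈ Ioo 0 T := fun x hx => ⟨hs.1.trans_le hx.1, hx.2.trans ht.2⟩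
    refine image_le_of_deriv_right_le_deriv_boundary (a := s) (b := t)
      (f := fun x => Real.exp (-(a * x)) * E x)
      (f' := fun x => Real.exp (-(a * x)) * -a * E x + Real.exp (-(a * x)) * E' x)
      (B := fun x => Real.exp (-(a * s)) * E s + b * (x - s)) (B' := fun _ => b)
      (hexpc.continuousOn.mul (hEc.mono (Icc_subset_Icc_left hs.1.le)))
      (fun x hx => (hexp x).hasDerivWithinAt.mul (hE' x (hI x hx))) (by simp) (by fun_prop)
      (fun x _ => ?_) (fun x hx => ?_) ⟨hs.2, le_rfl⟩
    · simpa using ((((hasDerivAt_id x).sub_const s).const_mul b).const_add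
        (Real.exp (-(a * s)) * E s)).hasDerivWithinAt
    · have h1 : Real.exp (-(a * x)) ≤ 1 :=
        Real.exp_le_one_iff.2 (neg_nonpos.2 (mul_nonneg ha0.le (hI x hx).1.le))
      have h2 := mul_le_mul_of_nonneg_left (hE'le x (hI x hx)) (Real.exp_pos (-(a * x))).le
      have h3 := mul_le_mul_of_nonneg_right h1 hb0.le
      linarith
  have hcl : Real.exp (-(a * t)) * E t ≤ Real.exp (-(a * 0)) * E 0 + b * (t - 0) := by
    have hR : ContinuousOn (fun s => Real.exp (-(a * s)) * E s + b * (t - s)) (Icc 0 t) :=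
      (hexpc.continuousOn.mul hEc).add (by fun_prop)
    have hlim : ContinuousWithinAt (fun s => Real.exp (-(a * s)) * E s + b * (t - s))
        (Ioc 0 t) 0 := (hR 0 ⟨le_rfl, ht0.le⟩).mono Ioc_subset_Icc_self
    have : (nhdsWithin (0:ℝ) (Ioc 0 t)).NeBot := by
      rw [nhdsWithin_Ioc_eq_nhdsGT ht0]; infer_instance
    exact ge_of_tendsto hlim.tendsto (Filter.eventually_of_mem self_mem_nhdsWithin key)
  simp only [mul_zero, neg_zero, Real.exp_zero, one_mul, sub_zero] at hcl
  calc E t = Real.exp (a * t) * (Real.exp (-(a * t)) * E t) := by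
        rw [← mul_assoc, ← Real.exp_add]; simp
    _ ≤ _ := mul_le_mul_of_nonneg_left hcl (Real.exp_pos _).le
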